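/- Let Γ be an access structure on 5 players satisfying monotonicity, no-cloning and no-redundancy with {1,2} ∈ Γ_min and {1,3,4} ∈ Γ_min, and suppose ψ is a pure QSS state for Γ. Then Γ_min = {{1,2}, {1,3,4}, {1,3,5}, {1,4,5}, {2,3,4}, {2,3,5}, {2,4,5}}, the 6-qubit state ψ is 2-uniform (every reduction to at most 2 qubit positions is maximally mixed), and exactly 18 of the 20 three-element subsets of the positions {0,1,…,5} have maximally mixed reductions, the two exceptions being {0,1,2} and {3,4,5} (where 0 indexes the reference qubit). -/

import Mathlib

open Finset

/-- Monotonicity of an access structure on `n` players (players = `Fin n`). -/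
def Monotonic {n : ℕ} (Γ : Finset (Fin n) → Prop) : Prop :=
  ∀ A B : Finset (Fin n), Γ A → A ⊆ B → Γ B

/-- No-cloning: a set is authorized iff its complement is not. -/
def NoCloning {n : ℕ} (Γ : Finset (Fin n) → Prop) : Prop :=
  ∀ A : Finset (Fin n), Γ A ↔ ¬ Γ Aᶜ

/-- `A` is a minimal authorized set of `Γ`. -/
def IsMinimal {n : ℕ} (Γ : Finset (Fin n) → Prop) (A : Finset (Fin n)) : Prop :=
  Γ A ∧ ∀ B : Finset (Fin n), B ⊂ A → ¬ Γ B

/-- No-redundancy: every player lies in some minimal authorized set. -/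
def NoRedundancy {n : ℕ} (Γ : Finset (Fin n) → Prop) : Prop :=
  ∀ i : Fin n, ∃ A : Finset (Fin n), IsMinimal Γ A ∧ i ∈ A

noncomputable section

/-- Combine an assignment on `A` and one on `Aᶜ` into a full bit string. -/
def glue {m : ℕ} (A : Finset (Fin m)) (u : {x // x ∈ A} → Fin 2)
    (w : {x // x ∈ Aᶜ} → Fin 2) : Fin m → Fin 2 :=
  fun x => if h : x ∈ A then u ⟨x, h⟩ else w ⟨x, Finset.mem_compl.mpr h⟩

/-- Reduced density matrix of the pure state `ψ` on the qubit positions in `A`: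
the partial trace over the positions outside `A` of `ψψ†`. -/
def reducedDensity {m : ℕ} (ψ : (Fin m → Fin 2) → ℂ) (A : Finset (Fin m)) :
    Matrix ({x // x ∈ A} → Fin 2) ({x // x ∈ A} → Fin 2) ℂ :=
  fun u v => ∑ w : {x // x ∈ Aᶜ} → Fin 2,
    ψ (glue A u w) * (starRingEnd ℂ) (ψ (glue A v w))

/-- The reduction of `ψ` to `A` is maximally mixed, i.e. equals `2^{-|A|} · I`. -/
def MaximallyMixed {m : ℕ} (ψ : (Fin m → Fin 2) → ℂ) (A : Finset (Fin m)) : Prop :=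
  reducedDensity ψ A =
    ((2 : ℂ) ^ A.card)⁻¹ •
      (1 : Matrix ({x // x ∈ A} → Fin 2) ({x // x ∈ A} → Fin 2) ℂ)

open Classical in
/-- Von Neumann entropy (natural logarithm): sum of `-λ log λ` over the eigenvalues. -/
def vnEntropy {ι : Type} [Fintype ι] [DecidableEq ι] (ρ : Matrix ι ι ℂ) : ℝ :=
  if h : ρ.IsHermitian then ∑ i, Real.negMulLog (h.eigenvalues i) else 0

/-- Entropy of the reduction of `ψ` to the set `A` of qubit positions. -/
def Sent {m : ℕ} (ψ : (Fin m → Fin 2) → ℂ) (A : Finset (Fin m)) : ℝ :=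
  vnEntropy (reducedDensity ψ A)

/-- The qubit positions (in `{0,1,…,n} = Fin (n+1)`, where `0` is the reference qubit)
of a set of players `A ⊆ Fin n`: player `i` holds position `i.succ`. -/
def posOf {n : ℕ} (A : Finset (Fin n)) : Finset (Fin (n + 1)) := A.image Fin.succ

/-- `ψ` is a pure QSS state for the access structure `Γ`: a normalized pure state of
`n+1` qubits (position `0` being the reference qubit `R`) satisfying Recoverability
`S(R) + S(A) - S(R ∪ A) = 2 log 2` for authorized `A` and Secrecy
`S(R) + S(B) - S(R ∪ B) = 0` for unauthorized `B`. -/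
structure IsPureQSSState {n : ℕ} (Γ : Finset (Fin n) → Prop)
    (ψ : (Fin (n + 1) → Fin 2) → ℂ) : Prop where
  normalized : ∑ x : Fin (n + 1) → Fin 2, ‖ψ x‖ ^ 2 = 1
  recover : ∀ A : Finset (Fin n), Γ A →
    Sent ψ {0} + Sent ψ (posOf A) - Sent ψ (insert 0 (posOf A)) = 2 * Real.log 2
  secrecy : ∀ B : Finset (Fin n), ¬ Γ B →
    Sent ψ {0} + Sent ψ (posOf B) - Sent ψ (insert 0 (posOf B)) = 0

end

section QSSaux
open scoped ComplexOrder

open Polynomial in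
lemma vnEntropy_eq_roots {ι : Type} [Fintype ι] [DecidableEq ι] {ρ : Matrix ι ι ℂ}
    (h : ρ.IsHermitian) :
    vnEntropy ρ = (ρ.charpoly.roots.map (fun z : ℂ => Real.negMulLog z.re)).sum := by
  unfold vnEntropy
  rw [dif_pos h, h.roots_charpoly_eq_eigenvalues, Multiset.map_map]
  rfl

lemma vnEntropy_congr {ι κ : Type} [Fintype ι] [DecidableEq ι] [Fintype κ] [DecidableEq κ]
    {ρ : Matrix ι ι ℂ} {σ : Matrix κ κ ℂ} (h : ρ.IsHermitian) (h' : σ.IsHermitian)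
    (hc : ρ.charpoly = σ.charpoly) : vnEntropy ρ = vnEntropy σ := by
  rw [vnEntropy_eq_roots h, vnEntropy_eq_roots h', hc]

open Polynomial in
lemma vnEntropy_mul_comm {ι κ : Type} [Fintype ι] [DecidableEq ι] [Fintype κ] [DecidableEq κ]
    (A : Matrix ι κ ℂ) (B : Matrix κ ι ℂ) (h : (A * B).IsHermitian) (h' : (B * A).IsHermitian) :
    vnEntropy (A * B) = vnEntropy (B * A) := by
  rw [vnEntropy_eq_roots h, vnEntropy_eq_roots h']
  have := Matrix.charpoly_mul_comm' A B
  have h2 := congrArg (fun p : ℂ[X] => (p.roots.map (fun z : ℂ => Real.negMulLog z.re)).sum) this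
  rw [roots_mul (mul_ne_zero (pow_ne_zero _ X_ne_zero) (Matrix.charpoly_monic _).ne_zero),
    roots_mul (mul_ne_zero (pow_ne_zero _ X_ne_zero) (Matrix.charpoly_monic _).ne_zero)] at h2
  simpa [Multiset.map_nsmul, Multiset.sum_nsmul] using h2

open Polynomial in
lemma vnEntropy_diagonal {ι : Type} [Fintype ι] [DecidableEq ι] (d : ι → ℝ) :
    vnEntropy (Matrix.diagonal (fun i => (d i : ℂ))) = ∑ i, Real.negMulLog (d i) := by
  rw [vnEntropy_eq_roots, Matrix.charpoly_diagonal, roots_prod]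
  · simp [Multiset.map_bind, Multiset.sum_bind, Multiset.bind_singleton]
  · exact Finset.prod_ne_zero_iff.2 fun i _ => X_sub_C_ne_zero _
  · rw [Matrix.isHermitian_diagonal_iff]
    intro i
    simp [isSelfAdjoint_iff]

lemma peierls {ι : Type} [Fintype ι] [DecidableEq ι] {M : Matrix ι ι ℂ} (hM : M.PosSemidef) :
    vnEntropy M ≤ ∑ k, Real.negMulLog (M k k).re ∧
    (vnEntropy M = ∑ k, Real.negMulLog (M k k).re → ∀ k l, k ≠ l → M k l = 0) := by
  have hH := hM.isHermitian
  obtain ⟨U, hUU, hUU', lam, hlam, hS, hdec⟩ : ∃ U : Matrix ι ι ℂ,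
      U * star U = 1 ∧ star U * U = 1 ∧ ∃ lam : ι → ℝ, (∀ j, 0 ≤ lam j) ∧
      vnEntropy M = ∑ j, Real.negMulLog (lam j) ∧
      ∀ k l, M k l = ∑ j, U k j * lam j * star (U l j) := by
    refine ⟨hH.eigenvectorUnitary, Unitary.coe_mul_star_self _, Unitary.coe_star_mul_self _,
      hH.eigenvalues, hM.eigenvalues_nonneg, ?_, ?_⟩
    · unfold vnEntropy
      rw [dif_pos hH]
    · intro k l
      conv_lhs => rw [hH.spectral_theorem, Unitary.conjStarAlgAut_apply]
      rw [Matrix.mul_apply]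
      refine Finset.sum_congr rfl fun j _ => ?_
      rw [Matrix.mul_diagonal]
      rfl
  have hrow : ∀ k l, ∑ j, U k j * star (U l j) = if k = l then 1 else 0 := by
    intro k l
    have := congrFun (congrFun hUU k) l
    rw [Matrix.mul_apply, Matrix.one_apply] at this
    exact this
  have hcs : ∀ z : ℂ, z * star z = ((Complex.normSq z : ℝ) : ℂ) := by
    intro z; exact Complex.mul_conj z
  have hD1 : ∀ k, ∑ j, Complex.normSq (U k j) = 1 := by
    intro k
    have := hrow k k
    simp only [hcs, if_true] at this
    exact_mod_cast this
  have hD2 : ∀ j, ∑ k, Complex.normSq (U k j) = 1 := by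
    intro j
    have := congrFun (congrFun hUU' j) j
    rw [Matrix.mul_apply, Matrix.one_apply, if_pos rfl] at this
    have h2 : ∀ k, (star U) j k * U k j = ((Complex.normSq (U k j) : ℝ) : ℂ) := by
      intro k
      rw [← hcs, mul_comm]; rfl
    simp only [h2] at this
    exact_mod_cast this
  have hdiag : ∀ k, M k k = ((∑ j, Complex.normSq (U k j) * lam j : ℝ) : ℂ) := by
    intro k
    rw [hdec]
    push_cast
    refine Finset.sum_congr rfl fun j _ => ?_
    rw [← hcs]; ring
  have hre : ∀ k, (M k k).re = ∑ j, Complex.normSq (U k j) • lam j := by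
    intro k; rw [hdiag, Complex.ofReal_re]; rfl
  have hjen : ∀ k, ∑ j, Complex.normSq (U k j) • Real.negMulLog (lam j) ≤
      Real.negMulLog (M k k).re := by
    intro k
    rw [hre]
    exact Real.concaveOn_negMulLog.le_map_sum (fun _ _ => Complex.normSq_nonneg _) (hD1 k)
      (fun j _ => hlam j)
  have hS' : vnEntropy M = ∑ k, ∑ j, Complex.normSq (U k j) • Real.negMulLog (lam j) := by
    rw [hS, Finset.sum_comm]
    refine Finset.sum_congr rfl fun j _ => ?_
    rw [← Finset.sum_smul, hD2, one_smul]
  refine ⟨hS' ▸ Finset.sum_le_sum fun k _ => hjen k, fun heq k l hkl => ?_⟩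
  rw [hS'] at heq
  have h1 := (Finset.sum_eq_sum_iff_of_le (fun k _ => hjen k)).1 heq k (Finset.mem_univ k)
  rw [hre] at h1
  have h2 := (Real.strictConcaveOn_negMulLog.map_sum_eq_iff'
    (fun _ _ => Complex.normSq_nonneg _) (hD1 k) (fun j _ => hlam j)).1 h1.symm
  rw [← hre] at h2
  rw [hdec]
  have : ∀ j, U k j * lam j * star (U l j) = (M k k).re * (U k j * star (U l j)) := by
    intro j
    by_cases h0 : U k j = 0
    · simp [h0]
    · rw [← h2 j (Finset.mem_univ j) (by simpa [Complex.normSq_eq_zero] using h0)]; ring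
  simp only [this]
  rw [← Finset.mul_sum, hrow, if_neg hkl, mul_zero]

lemma two_negMulLog (a b : ℝ) (ha : 0 ≤ a) (hb : 0 ≤ b) :
    Real.negMulLog a + Real.negMulLog b ≤ Real.negMulLog (a + b) + (a + b) * Real.log 2 ∧
    (Real.negMulLog a + Real.negMulLog b = Real.negMulLog (a + b) + (a + b) * Real.log 2 →
      a = b) := by
  have key : Real.negMulLog (a + b) + (a + b) * Real.log 2 =
      2 * Real.negMulLog ((1/2 : ℝ) • a + (1/2 : ℝ) • b) := by
    have : (1/2 : ℝ) • a + (1/2 : ℝ) • b = (1/2) * (a + b) := by simp only [smul_eq_mul]; ring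
    rw [this, Real.negMulLog_mul]
    have : Real.negMulLog (1/2 : ℝ) = (1/2) * Real.log 2 := by
      rw [Real.negMulLog, one_div, Real.log_inv]; ring
    rw [this]; ring
  rw [key]
  constructor
  · have := Real.concaveOn_negMulLog.2 ha hb
      (show (0:ℝ) ≤ 1/2 by norm_num) (show (0:ℝ) ≤ 1/2 by norm_num) (by norm_num)
    simp only [smul_eq_mul] at this ⊢
    linarith
  · intro h
    by_contra hne
    have := Real.strictConcaveOn_negMulLog.2 ha hb hne
      (show (0:ℝ) < 1/2 by norm_num) (show (0:ℝ) < 1/2 by norm_num) (by norm_num)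
    simp only [smul_eq_mul] at this h
    linarith

open Kronecker in
lemma subadd {α : Type} [Fintype α] [DecidableEq α]
    (N : Matrix (α × Fin 2) (α × Fin 2) ℂ) (hN : N.PosSemidef) (ρ : Matrix α α ℂ)
    (hρ : ρ.IsHermitian)
    (hpt : ∀ u v, ρ u v = ∑ b, N (u, b) (v, b)) (htr : ρ.trace = 1) :
    vnEntropy N ≤ vnEntropy ρ + Real.log 2 ∧
    (vnEntropy N = vnEntropy ρ + Real.log 2 ↔
      N = ρ ⊗ₖ ((1/2 : ℂ) • (1 : Matrix (Fin 2) (Fin 2) ℂ))) := by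
  obtain ⟨V, hVV, hVV', mu, hS, hdec⟩ : ∃ V : Matrix α α ℂ,
      V * star V = 1 ∧ star V * V = 1 ∧ ∃ mu : α → ℝ, 
      vnEntropy ρ = ∑ j, Real.negMulLog (mu j) ∧
      ρ = V * Matrix.diagonal (fun j => (mu j : ℂ)) * star V := by
    refine ⟨hρ.eigenvectorUnitary, Unitary.coe_mul_star_self _, Unitary.coe_star_mul_self _,
      hρ.eigenvalues, ?_, ?_⟩
    · unfold vnEntropy
      rw [dif_pos hρ]
    · conv_lhs => rw [hρ.spectral_theorem, Unitary.conjStarAlgAut_apply]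
      rfl
  have hdec' : star V * ρ * V = Matrix.diagonal (fun j => (mu j : ℂ)) := by
    rw [hdec]
    calc _ = (star V * V) * Matrix.diagonal (fun j => (mu j : ℂ)) * (star V * V) := by
          simp only [Matrix.mul_assoc]
      _ = _ := by rw [hVV']; simp
  have hmu : ∑ j, mu j = 1 := by
    have : (Matrix.diagonal (fun j => (mu j : ℂ))).trace = 1 := by
      rw [← hdec', Matrix.trace_mul_comm, ← Matrix.mul_assoc, hVV, Matrix.one_mul, htr]
    rw [Matrix.trace_diagonal] at this
    exact_mod_cast this
  set W : Matrix (α × Fin 2) (α × Fin 2) ℂ := V ⊗ₖ (1 : Matrix (Fin 2) (Fin 2) ℂ) with hW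
  have hWs : W.conjTranspose = (star V) ⊗ₖ (1 : Matrix (Fin 2) (Fin 2) ℂ) := by
    rw [hW, Matrix.conjTranspose_kronecker, Matrix.conjTranspose_one]; rfl
  have hWW : W * W.conjTranspose = 1 := by
    rw [hWs, hW, ← Matrix.mul_kronecker_mul, hVV, Matrix.one_mul, Matrix.one_kronecker_one]
  set M := W.conjTranspose * N * W with hMdef
  have hM : M.PosSemidef := hN.conjTranspose_mul_mul_same W
  have hSM : vnEntropy M = vnEntropy N := by
    apply vnEntropy_congr hM.isHermitian hN.isHermitian
    rw [hMdef, Matrix.charpoly_mul_comm, ← Matrix.mul_assoc, hWW, Matrix.one_mul]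
  have hNM : N = W * M * W.conjTranspose := by
    rw [hMdef]
    calc N = (W * W.conjTranspose) * N * (W * W.conjTranspose) := by rw [hWW]; simp
      _ = _ := by simp only [Matrix.mul_assoc]
  have hMe : ∀ k b l c, M (k, b) (l, c) = ∑ v, ∑ u, star (V u k) * N (u, b) (v, c) * V v l := by
    intro k b l c
    simp only [hMdef, Matrix.mul_apply, Fintype.sum_prod_type, hWs, hW, Matrix.kroneckerMap_apply,
      Matrix.one_apply, Finset.sum_mul]
    fin_cases b <;> fin_cases c <;> simp <;> rfl
  have hMd : ∀ k, (M (k, 0) (k, 0)).re + (M (k, 1) (k, 1)).re = mu k := by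
    intro k
    have h1 : M (k, 0) (k, 0) + M (k, 1) (k, 1) = mu k := by
      have := congrFun (congrFun hdec' k) k
      rw [Matrix.diagonal_apply_eq] at this
      rw [← this, hMe, hMe, Matrix.mul_apply, ← Finset.sum_add_distrib]
      refine Finset.sum_congr rfl fun v _ => ?_
      rw [← Finset.sum_add_distrib, Matrix.mul_apply, Finset.sum_mul]
      refine Finset.sum_congr rfl fun u _ => ?_
      rw [hpt, Fin.sum_univ_two, Matrix.star_apply]; ring
    have := congrArg Complex.re h1
    simpa using this
  have hnn : ∀ p, 0 ≤ (M p p).re := fun p => (Complex.le_def.1 (hM.diag_nonneg (i := p))).1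
  have hk := fun k => two_negMulLog _ _ (hnn (k, 0)) (hnn (k, 1))
  simp only [hMd] at hk
  obtain ⟨hp1, hp2⟩ := peierls hM
  have hsum : ∑ k, (Real.negMulLog (mu k) + mu k * Real.log 2) = vnEntropy ρ + Real.log 2 := by
    rw [Finset.sum_add_distrib, ← Finset.sum_mul, hmu, hS, one_mul]
  have hle2 : ∑ p, Real.negMulLog (M p p).re ≤ vnEntropy ρ + Real.log 2 := by
    rw [← hsum, Fintype.sum_prod_type]
    refine Finset.sum_le_sum fun k _ => ?_
    rw [Fin.sum_univ_two]
    exact (hk k).1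
  refine ⟨by rw [← hSM]; exact hp1.trans hle2, ?_, ?_⟩
  · intro heq
    rw [← hSM] at heq
    have e1 : vnEntropy M = ∑ p, Real.negMulLog (M p p).re := le_antisymm hp1 (heq ▸ hle2)
    have hoff := hp2 e1
    rw [e1, ← hsum, Fintype.sum_prod_type] at heq
    have h3 := (Finset.sum_eq_sum_iff_of_le (fun k _ => by
      rw [Fin.sum_univ_two]; exact (hk k).1)).1 heq
    have hd : ∀ k b, M (k, b) (k, b) = (mu k : ℂ) / 2 := by
      intro k b
      have h4 := h3 k (Finset.mem_univ k)
      rw [Fin.sum_univ_two] at h4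
      have h5 := (hk k).2 h4
      have h6 := hMd k
      have him : (M (k, b) (k, b)).im = 0 :=
        ((Complex.le_def.1 (hM.diag_nonneg (i := (k, b)))).2).symm
      have hr : (M (k, b) (k, b)).re = mu k / 2 := by
        fin_cases b <;> simp at * <;> linarith
      apply Complex.ext
      · rw [hr]; simp
      · rw [him]; simp
    have hMdiag : M = Matrix.diagonal (fun j => (mu j : ℂ)) ⊗ₖ
        ((1/2 : ℂ) • (1 : Matrix (Fin 2) (Fin 2) ℂ)) := by
      ext ⟨k, b⟩ ⟨l, c⟩
      rw [Matrix.kroneckerMap_apply]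
      by_cases hkl : k = l
      · by_cases hbc : b = c
        · subst hkl hbc
          rw [hd]; simp; ring
        · rw [hoff _ _ (by simp [hbc])]
          simp [hbc, Matrix.one_apply]
      · rw [hoff _ _ (by simp [hkl])]
        simp [hkl]
    rw [hNM, hMdiag, hWs, hW, ← Matrix.mul_kronecker_mul, ← Matrix.mul_kronecker_mul, ← hdec]
    simp
  · intro h
    have : M = Matrix.diagonal (fun p : α × Fin 2 => ((mu p.1 / 2 : ℝ) : ℂ)) := by
      rw [hMdef, h, hWs, hW, ← Matrix.mul_kronecker_mul, ← Matrix.mul_kronecker_mul, hdec']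
      ext ⟨k, b⟩ ⟨l, c⟩
      rw [Matrix.kroneckerMap_apply]
      by_cases hkl : k = l
      · by_cases hbc : b = c
        · subst hkl hbc
          simp; ring
        · simp [hbc, Matrix.one_apply, Matrix.diagonal_apply]
      · simp [hkl, Matrix.diagonal_apply]
    rw [← hSM, this, vnEntropy_diagonal, Fintype.sum_prod_type, ← hsum]
    refine Finset.sum_congr rfl fun k _ => ?_
    simp only [Fin.sum_univ_two]
    rw [div_eq_mul_inv, Real.negMulLog_mul, Real.negMulLog, Real.negMulLog, Real.log_inv]
    ring

lemma sum_glue {m : ℕ} (A : Finset (Fin m)) (f : (Fin m → Fin 2) → ℂ) :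
    ∑ z, f z = ∑ u : {x // x ∈ A} → Fin 2, ∑ w : {x // x ∈ Aᶜ} → Fin 2, f (glue A u w) := by
  rw [← Fintype.sum_prod_type' (f := fun u w => f (glue A u w))]
  refine (Fintype.sum_equiv (⟨fun p => glue A p.1 p.2, fun z => (fun a => z a, fun a => z a),
    ?_, ?_⟩ : ({x // x ∈ A} → Fin 2) × ({x // x ∈ Aᶜ} → Fin 2) ≃ (Fin m → Fin 2)) _ _ ?_).symm
  · rintro ⟨u, w⟩
    refine Prod.ext ?_ ?_
    · funext a
      simp [glue, a.2]
    · funext a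
      have := Finset.mem_compl.1 a.2
      simp [glue, this]
  · intro z
    funext a
    by_cases h : a ∈ A <;> simp [glue]
  · intro p; rfl

noncomputable def rr {m : ℕ} (ψ : (Fin m → Fin 2) → ℂ) (A : Finset (Fin m))
    (x y : Fin m → Fin 2) : ℂ :=
  ((2 : ℂ) ^ A.card)⁻¹ * ∑ z : Fin m → Fin 2,
    ψ (A.piecewise x z) * (starRingEnd ℂ) (ψ (A.piecewise y z))

lemma reducedDensity_eq_rr {m : ℕ} (ψ : (Fin m → Fin 2) → ℂ) (A : Finset (Fin m))
    (x y : Fin m → Fin 2) :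
    reducedDensity ψ A (fun a => x a) (fun a => y a) = rr ψ A x y := by
  unfold rr reducedDensity
  have hg : ∀ (x : Fin m → Fin 2) u w, A.piecewise x (glue A u w) = glue A (fun a => x a) w := by
    intro x u w
    funext a
    by_cases h : a ∈ A <;> simp [glue, h]
  rw [sum_glue A]
  simp only [hg]
  rw [Finset.sum_const, nsmul_eq_mul, Finset.card_univ]
  simp

lemma sum_update {m : ℕ} (i : Fin m) (f : (Fin m → Fin 2) → ℂ) :
    ∑ b : Fin 2, ∑ z, f (Function.update z i b) = 2 * ∑ z, f z := by
  have h : ∀ g : (Fin m → Fin 2) → ℂ, ∑ z, g z =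
      ∑ c : Fin 2, ∑ w : {j // j ≠ i} → Fin 2, g ((Equiv.funSplitAt i (Fin 2)).symm (c, w)) := by
    intro g
    rw [← Fintype.sum_prod_type']
    exact (Fintype.sum_equiv (Equiv.funSplitAt i (Fin 2)).symm _ _ (fun _ => rfl)).symm
  have hu : ∀ (c b : Fin 2) (w : {j // j ≠ i} → Fin 2),
      Function.update ((Equiv.funSplitAt i (Fin 2)).symm (c, w)) i b =
        (Equiv.funSplitAt i (Fin 2)).symm (b, w) := by
    intro c b w
    funext a
    by_cases ha : a = i
    · subst ha; simp [Equiv.funSplitAt, Equiv.piSplitAt]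
    · simp [Equiv.funSplitAt, Equiv.piSplitAt, ha]
  rw [h f]
  simp only [h (fun z => f (Function.update z i _)), hu]
  simp only [Fin.sum_univ_two]
  ring

lemma rr_congr {m : ℕ} (ψ : (Fin m → Fin 2) → ℂ) (A : Finset (Fin m))
    {x y x' y' : Fin m → Fin 2} (hx : ∀ a ∈ A, x a = x' a) (hy : ∀ a ∈ A, y a = y' a) :
    rr ψ A x y = rr ψ A x' y' := by
  unfold rr
  have h1 : ∀ z, A.piecewise x z = A.piecewise x' z := fun z => by
    funext a; by_cases h : a ∈ A <;> simp [h, hx]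
  have h2 : ∀ z, A.piecewise y z = A.piecewise y' z := fun z => by
    funext a; by_cases h : a ∈ A <;> simp [h, hy]
  simp only [h1, h2]

lemma rr_marg {m : ℕ} (ψ : (Fin m → Fin 2) → ℂ) (A : Finset (Fin m)) {i : Fin m} (hi : i ∉ A)
    (x y : Fin m → Fin 2) :
    rr ψ A x y = ∑ b, rr ψ (insert i A) (Function.update x i b) (Function.update y i b) := by
  have hp : ∀ (x z : Fin m → Fin 2) (b : Fin 2),
      (insert i A).piecewise (Function.update x i b) z =
        A.piecewise x (Function.update z i b) := by
    intro x z b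
    funext a
    by_cases ha : a = i
    · subst ha; simp [hi]
    · by_cases h : a ∈ A <;> simp [ha, h, Finset.piecewise]
  unfold rr
  simp only [hp]
  rw [← Finset.mul_sum, sum_update i (fun z => ψ (A.piecewise x z) *
    (starRingEnd ℂ) (ψ (A.piecewise y z))), Finset.card_insert_of_notMem hi, pow_succ]
  field_simp

def Free {m : ℕ} (ψ : (Fin m → Fin 2) → ℂ) (i : Fin m) (A : Finset (Fin m)) : Prop :=
  ∀ x y, rr ψ (insert i A) x y = if x i = y i then rr ψ A x y / 2 else 0

lemma free_step {m : ℕ} {ψ : (Fin m → Fin 2) → ℂ} {i j : Fin m} {A : Finset (Fin m)}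
    (hij : i ≠ j) (hj : j ∉ A) (h : Free ψ i (insert j A)) : Free ψ i A := by
  intro x y
  rw [rr_marg ψ (insert i A) (i := j) (by simp [hj, hij.symm]), rr_marg ψ A hj]
  simp only [Finset.insert_comm j i, h _ _, Function.update_of_ne hij]
  split_ifs
  · rw [Finset.sum_div]
  · simp

lemma free_mono {m : ℕ} {ψ : (Fin m → Fin 2) → ℂ} {i : Fin m} {A B : Finset (Fin m)}
    (hi : i ∉ A) (hBA : B ⊆ A) (h : Free ψ i A) : Free ψ i B := by
  have key : ∀ C : Finset (Fin m), i ∉ C → Disjoint B C → Free ψ i (C ∪ B) → Free ψ i B := by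
    intro C
    induction C using Finset.induction_on with
    | empty => intro _ _ h; simpa using h
    | insert j C hj ih =>
      intro hi hd h
      rw [Finset.insert_union] at h
      simp only [Finset.mem_insert, not_or] at hi
      rw [Finset.disjoint_insert_right] at hd
      exact ih hi.2 hd.2 (free_step hi.1 (by simp [hj, hd.1]) h)
  refine key (A \ B) (by simp [hi]) Finset.disjoint_sdiff ?_
  rwa [Finset.sdiff_union_of_subset hBA]

def MMr {m : ℕ} (ψ : (Fin m → Fin 2) → ℂ) (A : Finset (Fin m)) : Prop :=
  ∀ x y, rr ψ A x y = if ∀ a ∈ A, x a = y a then ((2 : ℂ) ^ A.card)⁻¹ else 0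

def lft {m : ℕ} (A : Finset (Fin m)) (u : {x // x ∈ A} → Fin 2) : Fin m → Fin 2 :=
  fun a => if h : a ∈ A then u ⟨a, h⟩ else 0

lemma lft_res {m : ℕ} (A : Finset (Fin m)) (u : {x // x ∈ A} → Fin 2) :
    (fun a : {x // x ∈ A} => lft A u a) = u := by
  funext a; simp [lft]

lemma mm_iff_r {m : ℕ} (ψ : (Fin m → Fin 2) → ℂ) (A : Finset (Fin m)) :
    MaximallyMixed ψ A ↔ MMr ψ A := by
  unfold MaximallyMixed MMr
  constructor
  · intro h x y
    rw [← reducedDensity_eq_rr, h, Matrix.smul_apply, Matrix.one_apply]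
    simp [funext_iff]
  · intro h
    ext u v
    rw [← lft_res A u, ← lft_res A v, reducedDensity_eq_rr, h, Matrix.smul_apply,
      Matrix.one_apply]
    simp [funext_iff]

lemma mmr_insert {m : ℕ} {ψ : (Fin m → Fin 2) → ℂ} {A : Finset (Fin m)} {i : Fin m}
    (hi : i ∉ A) : MMr ψ (insert i A) ↔ MMr ψ A ∧ Free ψ i A := by
  have hA : ∀ a ∈ A, a ≠ i := fun a ha h => hi (h ▸ ha)
  constructor
  · intro h
    have h1 : MMr ψ A := by
      intro x y
      rw [rr_marg ψ A hi]
      simp only [h _ _, Finset.card_insert_of_notMem hi, Finset.forall_mem_insert,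
        Function.update_self, true_and]
      have : ∀ b, (∀ a ∈ A, Function.update x i b a = Function.update y i b a) ↔
          ∀ a ∈ A, x a = y a := by
        intro b
        refine forall₂_congr fun a ha => ?_
        rw [Function.update_of_ne (hA a ha), Function.update_of_ne (hA a ha)]
      simp only [this, Fin.sum_univ_two]
      split_ifs
      · rw [pow_succ]; field_simp; norm_num
      · simp
    refine ⟨h1, fun x y => ?_⟩
    rw [h, h1, Finset.card_insert_of_notMem hi]
    simp only [Finset.forall_mem_insert, ite_and]
    split_ifs <;> simp [pow_succ, div_eq_mul_inv, mul_comm]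
  · rintro ⟨h1, h2⟩ x y
    rw [h2, h1, Finset.card_insert_of_notMem hi]
    simp only [Finset.forall_mem_insert, ite_and]
    split_ifs <;> simp [pow_succ, div_eq_mul_inv, mul_comm]

lemma mmr_mono {m : ℕ} {ψ : (Fin m → Fin 2) → ℂ} {A B : Finset (Fin m)}
    (hBA : B ⊆ A) (h : MMr ψ A) : MMr ψ B := by
  have key : ∀ C : Finset (Fin m), Disjoint B C → MMr ψ (C ∪ B) → MMr ψ B := by
    intro C
    induction C using Finset.induction_on with
    | empty => intro _ h; simpa using h
    | insert j C hj ih =>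
      intro hd h
      rw [Finset.insert_union] at h
      rw [Finset.disjoint_insert_right] at hd
      exact ih hd.2 ((mmr_insert (by simp [hj, hd.1])).1 h).1
  refine key (A \ B) Finset.disjoint_sdiff ?_
  rwa [Finset.sdiff_union_of_subset hBA]

def psiMat {m : ℕ} (ψ : (Fin m → Fin 2) → ℂ) (A : Finset (Fin m)) :
    Matrix ({x // x ∈ A} → Fin 2) ({x // x ∈ Aᶜ} → Fin 2) ℂ :=
  fun u w => ψ (glue A u w)

lemma rd_eq {m : ℕ} (ψ : (Fin m → Fin 2) → ℂ) (A : Finset (Fin m)) :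
    reducedDensity ψ A = psiMat ψ A * (psiMat ψ A).conjTranspose := rfl

lemma rd_psd {m : ℕ} (ψ : (Fin m → Fin 2) → ℂ) (A : Finset (Fin m)) :
    (reducedDensity ψ A).PosSemidef := by
  rw [rd_eq]; exact Matrix.posSemidef_self_mul_conjTranspose _

lemma Sent_compl {m : ℕ} (ψ : (Fin m → Fin 2) → ℂ) (A : Finset (Fin m)) :
    Sent ψ Aᶜ = Sent ψ A := by
  unfold Sent
  have h1 : reducedDensity ψ Aᶜ = ((psiMat ψ A).conjTranspose * psiMat ψ A).transpose := by
    ext u v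
    rw [Matrix.transpose_apply, Matrix.mul_apply]
    unfold reducedDensity
    refine Fintype.sum_equiv (Equiv.arrowCongr (Equiv.subtypeEquivRight (by simp)) (Equiv.refl _))
      _ _ ?_
    intro w
    have hg : ∀ u : {x // x ∈ Aᶜ} → Fin 2, glue Aᶜ u w = glue A ((Equiv.arrowCongr
        (Equiv.subtypeEquivRight (by simp)) (Equiv.refl _)) w) u := by
      intro u
      funext a
      by_cases h : a ∈ A
      · simp [glue, h, Equiv.arrowCongr, Equiv.subtypeEquivRight]
        rfl
      · simp [glue, h]
    rw [hg u, hg v, mul_comm]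
    rfl
  rw [h1, rd_eq, vnEntropy_mul_comm]
  · apply vnEntropy_congr
    · exact (Matrix.isHermitian_conjTranspose_mul_self _).transpose
    · exact Matrix.isHermitian_conjTranspose_mul_self _
    · exact Matrix.charpoly_transpose _
  · exact Matrix.isHermitian_mul_conjTranspose_self _
  · exact Matrix.isHermitian_conjTranspose_mul_self _

lemma rd_trace {m : ℕ} {ψ : (Fin m → Fin 2) → ℂ} (hn : ∑ x, ‖ψ x‖ ^ 2 = 1)
    (A : Finset (Fin m)) : (reducedDensity ψ A).trace = 1 := by
  have : ∑ x, ψ x * (starRingEnd ℂ) (ψ x) = 1 := by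
    simp only [Complex.mul_conj, Complex.normSq_eq_norm_sq]
    exact_mod_cast hn
  rw [sum_glue A] at this
  exact this

def insEquiv {m : ℕ} (A : Finset (Fin m)) (i : Fin m) (hi : i ∉ A) :
    ({x // x ∈ insert i A} → Fin 2) ≃ ({x // x ∈ A} → Fin 2) × Fin 2 where
  toFun f := (fun a => f ⟨a, Finset.mem_insert_of_mem a.2⟩, f ⟨i, Finset.mem_insert_self i A⟩)
  invFun p := fun a => Function.update (lft A p.1) i p.2 a
  left_inv f := by
    funext ⟨a, ha⟩
    by_cases h : a = i
    · subst h; simp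
    · have : a ∈ A := by simpa [h] using ha
      simp [h, lft, this]
  right_inv p := by
    refine Prod.ext ?_ ?_
    · funext ⟨a, ha⟩
      have : a ≠ i := fun h => hi (h ▸ ha)
      simp [this, lft, ha]
    · simp

open Kronecker in
lemma Sent_insert {m : ℕ} {ψ : (Fin m → Fin 2) → ℂ} (hn : ∑ x, ‖ψ x‖ ^ 2 = 1)
    {A : Finset (Fin m)} {i : Fin m} (hi : i ∉ A) :
    Sent ψ (insert i A) ≤ Sent ψ A + Real.log 2 ∧
    (Sent ψ (insert i A) = Sent ψ A + Real.log 2 ↔ Free ψ i A) := by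
  have hA : ∀ a ∈ A, a ≠ i := fun a ha h => hi (h ▸ ha)
  obtain ⟨N, hNdef⟩ : ∃ N, N = Matrix.reindex (insEquiv A i hi) (insEquiv A i hi)
    (reducedDensity ψ (insert i A)) := ⟨_, rfl⟩
  have hN : N.PosSemidef := by
    rw [hNdef]; exact (rd_psd ψ (insert i A)).submatrix _
  have hNe : ∀ u b v c, N (u, b) (v, c) = rr ψ (insert i A) (Function.update (lft A u) i b)
      (Function.update (lft A v) i c) := by
    intro u b v c
    rw [hNdef]
    exact reducedDensity_eq_rr ψ (insert i A) (Function.update (lft A u) i b)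
      (Function.update (lft A v) i c)
  have hS : vnEntropy N = Sent ψ (insert i A) := by
    apply vnEntropy_congr hN.isHermitian (rd_psd ψ (insert i A)).isHermitian
    rw [hNdef, Matrix.charpoly_reindex]
  have hρ : ∀ u v, reducedDensity ψ A u v = rr ψ A (lft A u) (lft A v) := by
    intro u v
    rw [← reducedDensity_eq_rr, lft_res, lft_res]
  have := subadd N hN (reducedDensity ψ A) (rd_psd ψ A).isHermitian (by
    intro u v
    rw [hρ, rr_marg ψ A hi]
    simp only [hNe]) (rd_trace hn A)
  rw [hS] at this
  refine ⟨this.1, this.2.trans ?_⟩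
  constructor
  · intro h x y
    have h2 := congrFun (congrFun h ((fun a => x a), x i)) ((fun a => y a), y i)
    rw [hNe, Matrix.kroneckerMap_apply, reducedDensity_eq_rr] at h2
    have hx : ∀ x : Fin m → Fin 2, ∀ a ∈ insert i A,
        x a = Function.update (lft A (fun a => x a)) i (x i) a := by
      intro x a ha
      by_cases h : a = i
      · subst h; simp
      · have : a ∈ A := by simpa [h] using ha
        simp [h, lft, this]
    rw [rr_congr ψ (insert i A) (hx x) (hx y), h2, Matrix.smul_apply, Matrix.one_apply]
    split_ifs <;> simp [div_eq_mul_inv]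
  · intro h
    ext ⟨u, b⟩ ⟨v, c⟩
    rw [hNe, h, Matrix.kroneckerMap_apply, hρ, Matrix.smul_apply, Matrix.one_apply]
    simp only [Function.update_self]
    rw [rr_congr ψ A (x' := lft A u) (y' := lft A v)
      (fun a ha => Function.update_of_ne (hA a ha) _ _)
      (fun a ha => Function.update_of_ne (hA a ha) _ _)]
    split_ifs <;> simp [div_eq_mul_inv]

lemma rd_empty {m : ℕ} {ψ : (Fin m → Fin 2) → ℂ} (hn : ∑ x, ‖ψ x‖ ^ 2 = 1) :
    reducedDensity ψ ∅ = 1 := by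
  have h := rd_trace hn ∅
  ext u v
  have huv : u = v := Subsingleton.elim _ _
  subst huv
  rw [Matrix.one_apply_eq, ← h, Matrix.trace]
  have : (Finset.univ : Finset ({x // x ∈ (∅ : Finset (Fin m))} → Fin 2)) = {u} := by
    ext z; rw [Finset.mem_singleton]; exact iff_of_true (Finset.mem_univ _) (Subsingleton.elim z u)
  rw [this, Finset.sum_singleton]; rfl

lemma Sent_empty {m : ℕ} {ψ : (Fin m → Fin 2) → ℂ} (hn : ∑ x, ‖ψ x‖ ^ 2 = 1) :
    Sent ψ ∅ = 0 := by
  unfold Sent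
  rw [rd_empty hn]
  have := vnEntropy_diagonal (fun _ : {x // x ∈ (∅ : Finset (Fin m))} → Fin 2 => (1 : ℝ))
  simpa using this

lemma Sent_le {m : ℕ} {ψ : (Fin m → Fin 2) → ℂ} (hn : ∑ x, ‖ψ x‖ ^ 2 = 1)
    (A : Finset (Fin m)) : Sent ψ A ≤ A.card * Real.log 2 ∧
      (Sent ψ A = A.card * Real.log 2 ↔ MMr ψ A) := by
  induction A using Finset.induction_on with
  | empty =>
    refine ⟨by simp [Sent_empty hn], iff_of_true (by simp [Sent_empty hn]) ?_⟩
    rw [← mm_iff_r]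
    unfold MaximallyMixed
    rw [rd_empty hn]; simp
  | insert i A hi ih =>
    obtain ⟨h1, h2⟩ := Sent_insert hn hi
    rw [mmr_insert hi, ← ih.2, ← h2, Finset.card_insert_of_notMem hi]
    push_cast
    refine ⟨by linarith [ih.1], fun h => ⟨by linarith [ih.1], by linarith [ih.1]⟩, fun h => ?_⟩
    rw [h.2, h.1]; ring

lemma compl_pos {n : ℕ} (A : Finset (Fin n)) : (posOf A)ᶜ = insert 0 (posOf Aᶜ) := by
  ext i
  refine Fin.cases ?_ (fun j => ?_) i
  · simp [posOf]
  · simp [posOf]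

lemma compl_pos' {n : ℕ} (A : Finset (Fin n)) : (insert 0 (posOf A))ᶜ = posOf Aᶜ := by
  have := compl_pos Aᶜ
  rw [compl_compl] at this
  rw [← this, compl_compl]

lemma posOf_insert {n : ℕ} (i : Fin n) (A : Finset (Fin n)) :
    posOf (insert i A) = insert i.succ (posOf A) := by
  simp [posOf, Finset.image_insert]

lemma succ_mem_posOf {n : ℕ} (i : Fin n) (A : Finset (Fin n)) : i.succ ∈ posOf A ↔ i ∈ A := by
  simp [posOf]

lemma zero_notMem_posOf {n : ℕ} (A : Finset (Fin n)) : (0 : Fin (n+1)) ∉ posOf A := by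
  simp [posOf]

structure QF {n : ℕ} (Γ : Finset (Fin n) → Prop) (ψ : (Fin (n + 1) → Fin 2) → ℂ) : Prop where
  auth : ∀ A, Γ A → Sent ψ (insert 0 (posOf A)) = Sent ψ (posOf A) - Real.log 2
  zfree : ∀ A, ¬ Γ A → Free ψ 0 (posOf A)
  crit : ∀ i B, i ∉ B → Γ (insert i B) → ¬ Γ B → Free ψ i.succ (posOf B)

lemma qf_of {n : ℕ} {Γ : Finset (Fin n) → Prop} {ψ : (Fin (n + 1) → Fin 2) → ℂ}
    (hnc : NoCloning Γ) (hψ : IsPureQSSState Γ ψ) (hex : ∃ A, Γ A) : QF Γ ψ := by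
  have hn := hψ.normalized
  have c1 : ∀ A, Sent ψ (insert 0 (posOf A)) = Sent ψ (posOf Aᶜ) := fun A => by
    rw [← Sent_compl, compl_pos']
  have hR : Sent ψ {0} = Real.log 2 := by
    obtain ⟨A, hA⟩ := hex
    have h1 := hψ.recover A hA
    have h2 := (Sent_insert hn (zero_notMem_posOf Aᶜ)).1
    rw [c1, compl_compl] at h2
    rw [c1] at h1
    have h3 := (Sent_le hn {0}).1
    simp at h3
    linarith
  have auth : ∀ A, Γ A → Sent ψ (insert 0 (posOf A)) = Sent ψ (posOf A) - Real.log 2 := by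
    intro A hA
    have := hψ.recover A hA
    linarith
  refine ⟨auth, ?_, ?_⟩
  · intro A hA
    have := hψ.secrecy A hA
    rw [← (Sent_insert hn (zero_notMem_posOf A)).2]
    linarith
  · intro i B hi hA hB
    have hi' : i.succ ∉ posOf B := by rwa [succ_mem_posOf]
    obtain ⟨h1, h2⟩ := Sent_insert hn hi'
    rw [← h2]
    have h3 := auth _ hA
    rw [c1] at h3
    have h4 := auth Bᶜ (by rw [hnc]; rwa [compl_compl])
    rw [c1, compl_compl] at h4
    have h5 : i.succ ∉ posOf (insert i B)ᶜ := by rw [succ_mem_posOf]; simp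
    have h6 := (Sent_insert hn h5).1
    rw [← posOf_insert] at h6
    have h7 : insert i (insert i B)ᶜ = Bᶜ := by
      ext j
      by_cases hj : j = i
      · subst hj; simp [hi]
      · simp [hj]
    rw [h7] at h6
    rw [posOf_insert] at h3
    linarith

lemma tri_mm {n : ℕ} {Γ : Finset (Fin n) → Prop} {ψ : (Fin (n + 1) → Fin 2) → ℂ}
    (hn : ∑ x, ‖ψ x‖ ^ 2 = 1) (q : QF Γ ψ)
    (hs : ∀ i, Free ψ (Fin.succ i) ∅) (a b c : Fin n) (hab : a ≠ b) (hac : a ≠ c) (hbc : b ≠ c)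
    (h : Γ {c, b, a}) (h1 : ¬ Γ {b, a}) (h2 : ¬ Γ {c, a}) : MMr ψ (posOf {c, b, a}) := by
  have f1 := q.crit c {b, a} (by simp [hbc.symm, hac.symm]) h h1
  have f2 := q.crit b {c, a} (by simp [hbc, hab.symm]) (by rwa [Finset.insert_comm]) h2
  have f3 : Free ψ b.succ (posOf {a}) := by
    refine free_mono ?_ ?_ f2
    · rw [succ_mem_posOf]; simp [hbc, hab.symm]
    · exact Finset.image_subset_image (by simp)
  have f4 := hs a
  have m0 : MMr ψ ∅ := (Sent_le hn ∅).2.1 (by simp [Sent_empty hn])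
  have m1 : MMr ψ (posOf {a}) := by
    rw [← insert_empty_eq, posOf_insert, mmr_insert (by simp [posOf])]
    exact ⟨m0, f4⟩
  rw [posOf_insert, mmr_insert (by rw [succ_mem_posOf]; simp [hbc.symm, hac.symm])]
  refine ⟨?_, f1⟩
  rw [posOf_insert, mmr_insert (by rw [succ_mem_posOf]; simp [hab.symm])]
  exact ⟨m1, f3⟩

lemma contra5 {n : ℕ} {Γ : Finset (Fin n) → Prop} {ψ : (Fin (n + 1) → Fin 2) → ℂ}
    (hn : ∑ x, ‖ψ x‖ ^ 2 = 1) (q : QF Γ ψ)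
    (hs : ∀ i, Free ψ (Fin.succ i) ∅) (hu : ∀ i, ¬ Γ {i}) (a b c d e : Fin n)
    (hab : a ≠ b) (hac : a ≠ c) (hbc : b ≠ c) (hed : e ∉ ({a, d} : Finset (Fin n)))
    (hcompl : ({c, a, b} : Finset (Fin n))ᶜ = {e, d})
    (g1 : Γ {a, b}) (g2 : Γ {a, c}) (g3 : Γ {e, a, d}) (g4 : ¬ Γ {a, d}) : False := by
  have s1 : ∀ i : Fin n, Sent ψ (posOf {i}) = Real.log 2 := by
    intro i
    have := (Sent_insert hn (Finset.notMem_empty i.succ)).2.2 (hs i)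
    rw [Sent_empty hn] at this
    simpa [posOf] using this
  have s2 : ∀ i j : Fin n, i ≠ j → Free ψ i.succ (posOf {j}) →
      Sent ψ (posOf {i, j}) = 2 * Real.log 2 := by
    intro i j hij h
    have := (Sent_insert hn (by rw [succ_mem_posOf]; simpa using hij)).2.2 h
    rw [← posOf_insert, s1] at this
    linarith
  have sab := s2 a b hab (q.crit a {b} (by simpa using hab) g1 (hu b))
  have sac := s2 a c hac (q.crit a {c} (by simpa using hac) g2 (hu c))
  have fe : Free ψ e.succ (posOf {d}) :=
    free_mono (A := posOf {a, d}) (by rwa [succ_mem_posOf])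
      (Finset.image_subset_image (by simp)) (q.crit e {a, d} hed g3 g4)
  have sed := s2 e d (by rintro rfl; simp at hed) fe
  have s0ab := q.auth _ g1
  have s0ac := q.auth _ g2
  have s0abc : Sent ψ (insert 0 (posOf {c, a, b})) = 2 * Real.log 2 := by
    rw [← Sent_compl, compl_pos', hcompl, sed]
  have hc : c.succ ∉ insert 0 (posOf {a, b}) := by
    rw [Finset.mem_insert, succ_mem_posOf]
    simp [hac.symm, hbc.symm]
  have fc : Free ψ c.succ (insert 0 (posOf {a, b})) := by
    rw [← (Sent_insert hn hc).2, Finset.insert_comm, ← posOf_insert, s0abc]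
    linarith
  have hsub : insert 0 (posOf {a}) ⊆ insert 0 (posOf {a, b}) :=
    Finset.insert_subset_insert _ (Finset.image_subset_image (by simp))
  have fc' : Free ψ c.succ (insert 0 (posOf {a})) := free_mono hc hsub fc
  have e1 := (Sent_insert hn (fun h => hc (hsub h))).2.2 fc'
  have e2 := (Sent_insert hn (zero_notMem_posOf {a})).2.2 (q.zfree {a} (hu a))
  rw [Finset.insert_comm, ← posOf_insert, Finset.pair_comm] at e1
  have := s1 a
  have hl := Real.log_pos (show (1:ℝ) < 2 by norm_num)
  linarith

def TT (A : Finset (Fin 5)) : Prop :=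
  {0, 1} ⊆ A ∨ {0, 2, 3} ⊆ A ∨ {0, 2, 4} ⊆ A ∨ {0, 3, 4} ⊆ A ∨ {1, 2, 3} ⊆ A ∨
    {1, 2, 4} ⊆ A ∨ {1, 3, 4} ⊆ A

instance : DecidablePred TT := fun A => by unfold TT; infer_instance

lemma TT_compl : ∀ A, ¬ TT A → TT Aᶜ := by decide

set_option maxRecDepth 100000 in
lemma TT_min : ∀ A : Finset (Fin 5), (TT A ∧ ∀ B ∈ A.ssubsets, ¬ TT B) ↔
      (A = {0, 1} ∨ A = {0, 2, 3} ∨ A = {0, 2, 4} ∨ A = {0, 3, 4} ∨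
       A = {1, 2, 3} ∨ A = {1, 2, 4} ∨ A = {1, 3, 4}) := by decide

set_option maxRecDepth 100000 in
lemma triples : ∀ A : Finset (Fin 6), A.card = 3 → A ≠ {0, 1, 2} → A ≠ {3, 4, 5} →
    ∃ X ∈ [({1, 3, 4} : Finset (Fin 6)), {1, 3, 5}, {1, 4, 5}, {2, 3, 4}, {2, 3, 5}, {2, 4, 5},
      {1, 2, 3}, {1, 2, 4}, {1, 2, 5}], A = X ∨ A = Xᶜ := by decide

set_option maxRecDepth 100000 in
lemma pairs : ∀ A : Finset (Fin 6), A.card ≤ 2 →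
    ∃ B ∈ [({1, 3, 4} : Finset (Fin 6)), {1, 3, 5}, {1, 4, 5}, {2, 3, 4}, {2, 3, 5},
      {2, 4, 5}, {1, 2, 3}, {0, 1, 3}, {0, 4, 5}, {0, 2, 3}], A ⊆ B := by decide

end QSSaux

/-- Players `1,…,5` are represented by `0,…,4 : Fin 5`; qubit positions are
`Fin 6`, with position `0` the reference qubit and player `i` at position `i+1`.
So the minimal authorized sets `{1,2}` and `{1,3,4}` of the paper are
`{0,1}` and `{0,2,3} : Finset (Fin 5)`, and the exceptional position sets
`{0,1,2}` and `{3,4,5}` of the paper are literally `{0,1,2}` and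
`{3,4,5} : Finset (Fin 6)`. -/
theorem stmt18 (Γ : Finset (Fin 5) → Prop)
    (hmono : Monotonic Γ) (hnc : NoCloning Γ) (hnr : NoRedundancy Γ)
    (h12 : IsMinimal Γ ({0, 1} : Finset (Fin 5)))
    (h134 : IsMinimal Γ ({0, 2, 3} : Finset (Fin 5)))
    (ψ : (Fin (5 + 1) → Fin 2) → ℂ) (hψ : IsPureQSSState Γ ψ) :
    (∀ A : Finset (Fin 5), IsMinimal Γ A ↔
      (A = {0, 1} ∨ A = {0, 2, 3} ∨ A = {0, 2, 4} ∨ A = {0, 3, 4} ∨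
       A = {1, 2, 3} ∨ A = {1, 2, 4} ∨ A = {1, 3, 4})) ∧
    (∀ A : Finset (Fin (5 + 1)), A.card ≤ 2 → MaximallyMixed ψ A) ∧
    (∀ A : Finset (Fin (5 + 1)), A.card = 3 →
      (MaximallyMixed ψ A ↔ (A ≠ {0, 1, 2} ∧ A ≠ {3, 4, 5}))) := by 
  have hn := hψ.normalized
  have q : QF Γ ψ := qf_of hnc hψ ⟨_, h12.1⟩
  have hs : ∀ i : Fin 5, Free ψ i.succ ∅ := by
    intro i
    obtain ⟨A, hA, hi⟩ := hnr i
    have hie : i ∉ A.erase i := Finset.notMem_erase i A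
    have := q.crit i (A.erase i) hie (by rw [Finset.insert_erase hi]; exact hA.1)
      (hA.2 _ (Finset.erase_ssubset hi))
    exact free_mono (by rwa [succ_mem_posOf]) (Finset.empty_subset _) this
  have hdisj : ∀ A B : Finset (Fin 5), Γ A → B ⊆ Aᶜ → ¬ Γ B := by
    intro A B hA hB hB'
    exact (hnc A).1 hA (hmono B _ hB' hB)
  have hco : ∀ A B : Finset (Fin 5), ¬ Γ A → B = Aᶜ → Γ B := by
    intro A B hA hB
    rw [hnc, hB, compl_compl]; exact hA
  have hu : ∀ i : Fin 5, ¬ Γ {i} := by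
    intro i
    fin_cases i
    · exact h12.2 _ (by decide)
    · exact h12.2 _ (by decide)
    · exact hdisj _ _ h12.1 (by decide)
    · exact hdisj _ _ h12.1 (by decide)
    · exact hdisj _ _ h12.1 (by decide)
  have n02 : ¬ Γ {0, 2} := h134.2 _ (by decide)
  have n03 : ¬ Γ {0, 3} := h134.2 _ (by decide)
  have n14 : ¬ Γ {1, 4} := hdisj _ _ h134.1 (by decide)
  have g134 : Γ {1, 3, 4} := hco _ _ n02 (by decide)
  have g124 : Γ {1, 2, 4} := hco _ _ n03 (by decide)
  have g10 : Γ {1, 0} := by rw [Finset.pair_comm]; exact h12.1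
  have n04 : ¬ Γ {0, 4} := fun h => contra5 hn q hs hu 0 1 4 3 2 (by decide) (by decide)
    (by decide) (by decide) (by decide) h12.1 h
    (by rw [show ({2, 0, 3} : Finset (Fin 5)) = {0, 2, 3} by decide]; exact h134.1) n03
  have n12 : ¬ Γ {1, 2} := fun h => contra5 hn q hs hu 1 0 2 4 3 (by decide) (by decide)
    (by decide) (by decide) (by decide) g10 h
    (by rw [show ({3, 1, 4} : Finset (Fin 5)) = {1, 3, 4} by decide]; exact g134) n14
  have n13 : ¬ Γ {1, 3} := fun h => contra5 hn q hs hu 1 0 3 4 2 (by decide) (by decide)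
    (by decide) (by decide) (by decide) g10 h
    (by rw [show ({2, 1, 4} : Finset (Fin 5)) = {1, 2, 4} by decide]; exact g124) n14
  have hT1 : ∀ A, TT A → Γ A := by
    rintro A (h | h | h | h | h | h | h)
    · exact hmono _ _ h12.1 h
    · exact hmono _ _ h134.1 h
    · exact hmono _ _ (hco _ _ n13 (by decide)) h
    · exact hmono _ _ (hco _ _ n12 (by decide)) h
    · exact hmono _ _ (hco _ _ n04 (by decide)) h
    · exact hmono _ _ g124 h
    · exact hmono _ _ g134 h
  have hT : ∀ A, Γ A ↔ TT A := by
    intro A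
    refine ⟨fun h => ?_, hT1 A⟩
    by_contra hA
    exact (hnc A).1 h (hT1 _ (TT_compl A hA))
  have tri : ∀ a b c : Fin 5, a ≠ b → a ≠ c → b ≠ c → TT {c, b, a} → ¬ TT {b, a} →
      ¬ TT {c, a} → MMr ψ (posOf {c, b, a}) := by
    intro a b c h1 h2 h3 h4 h5 h6
    exact tri_mm hn q hs a b c h1 h2 h3 ((hT _).2 h4) (fun h => h5 ((hT _).1 h))
      (fun h => h6 ((hT _).1 h))
  have hXc : ∀ X : Finset (Fin 6), X.card = 3 → MMr ψ X → MMr ψ Xᶜ := by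
    intro X hX h
    rw [← (Sent_le hn _).2, Sent_compl, Finset.card_compl, hX, (Sent_le hn X).2.2 h, hX]
    norm_num
  have hX : ∀ X ∈ [({1, 3, 4} : Finset (Fin 6)), {1, 3, 5}, {1, 4, 5}, {2, 3, 4}, {2, 3, 5},
      {2, 4, 5}, {1, 2, 3}, {1, 2, 4}, {1, 2, 5}], X.card = 3 ∧ MMr ψ X := by
    intro X hX
    simp only [List.mem_cons, List.not_mem_nil, or_false] at hX
    rcases hX with rfl | rfl | rfl | rfl | rfl | rfl | rfl | rfl | rfl
    · exact ⟨by decide, tri 3 2 0 (by decide) (by decide) (by decide) (by decide) (by decide)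
        (by decide)⟩
    · exact ⟨by decide, tri 4 2 0 (by decide) (by decide) (by decide) (by decide) (by decide)
        (by decide)⟩
    · exact ⟨by decide, tri 4 3 0 (by decide) (by decide) (by decide) (by decide) (by decide)
        (by decide)⟩
    · exact ⟨by decide, tri 3 2 1 (by decide) (by decide) (by decide) (by decide) (by decide)
        (by decide)⟩
    · exact ⟨by decide, tri 4 2 1 (by decide) (by decide) (by decide) (by decide) (by decide)
        (by decide)⟩
    · exact ⟨by decide, tri 4 3 1 (by decide) (by decide) (by decide) (by decide) (by decide)
        (by decide)⟩
    · exact ⟨by decide, tri 2 1 0 (by decide) (by decide) (by decide) (by decide) (by decide)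
        (by decide)⟩
    · exact ⟨by decide, tri 3 1 0 (by decide) (by decide) (by decide) (by decide) (by decide)
        (by decide)⟩
    · exact ⟨by decide, tri 4 1 0 (by decide) (by decide) (by decide) (by decide) (by decide)
        (by decide)⟩
  have h3 : ∀ A : Finset (Fin 6), A.card = 3 → A ≠ {0, 1, 2} → A ≠ {3, 4, 5} → MMr ψ A := by
    intro A hA h1 h2
    obtain ⟨X, hXm, rfl | rfl⟩ := triples A hA h1 h2
    · exact (hX _ hXm).2
    · exact hXc X (hX X hXm).1 (hX X hXm).2
  have hl := Real.log_pos (show (1:ℝ) < 2 by norm_num)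
  have hS012 : Sent ψ {0, 1, 2} ≤ Real.log 2 := by
    have h1 := q.auth _ h12.1
    have h2 := (Sent_le hn (posOf {0, 1})).1
    rw [show (posOf ({0, 1} : Finset (Fin 5))).card = 2 by decide] at h2
    rw [show insert 0 (posOf ({0, 1} : Finset (Fin 5))) = {0, 1, 2} by decide] at h1
    push_cast at h2
    linarith
  have hS345 : Sent ψ {3, 4, 5} ≤ Real.log 2 := by
    rw [show ({3, 4, 5} : Finset (Fin (5 + 1))) = ({0, 1, 2} : Finset (Fin (5 + 1)))ᶜ by decide,
      Sent_compl]
    exact hS012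
  refine ⟨?_, ?_, ?_⟩
  · intro A
    rw [← TT_min]
    unfold IsMinimal
    simp only [hT, Finset.mem_ssubsets]
  · intro A hA
    rw [mm_iff_r]
    obtain ⟨B, hB, hAB⟩ := pairs A hA
    refine mmr_mono hAB ?_
    have : ∀ B ∈ [({1, 3, 4} : Finset (Fin 6)), {1, 3, 5}, {1, 4, 5}, {2, 3, 4}, {2, 3, 5},
      {2, 4, 5}, {1, 2, 3}, {0, 1, 3}, {0, 4, 5}, {0, 2, 3}],
      B.card = 3 ∧ B ≠ {0, 1, 2} ∧ B ≠ {3, 4, 5} := by decide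
    obtain ⟨k1, k2, k3⟩ := this B hB
    exact h3 B k1 k2 k3
  · intro A hA
    rw [mm_iff_r]
    refine ⟨fun h => ?_, fun h => h3 A hA h.1 h.2⟩
    have h5 := (Sent_le hn A).2.2 h
    rw [hA] at h5
    push_cast at h5
    constructor
    · rintro rfl
      linarith
    · rintro rfl
      linarith
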